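/- arXiv:2209.00715 — 3 statements merged into one kernel-verified Lean document; each statement's English description precedes it below -/
import Mathlib

section
/- Suppose there exists p ∈ B with ψ(p) not ≥ 0, and let q be the maximal element of H = {p ∈ B : p is strongly negative with respect to ψ}. Then ψ(q) = β := inf{ψ(p) : p ∈ H} and β < 0. -/
/-- In a (Dedekind complete) Riesz space `E`, the band projection of `x` onto the
band generated by `u`, given by `P_u x = sup_n (x⁺ ⊓ n|u|) - sup_n (x⁻ ⊓ n|u|)`.
For a component `p` of a weak order unit this is the product `p x`. -/
noncomputable def bandProj {E : Type*} [AddCommGroup E] [ConditionallyCompleteLattice E]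
    [CovariantClass E E (· + ·) (· ≤ ·)] (u x : E) : E :=
  sSup (Set.range fun n : ℕ => (x ⊔ 0) ⊓ n • |u|) -
    sSup (Set.range fun n : ℕ => ((-x) ⊔ 0) ⊓ n • |u|)

/-- `p` is a component of the weak order unit `e`: `0 ≤ p ≤ e` and `p ∧ (e - p) = 0`. -/
def IsComponent {E : Type*} [AddCommGroup E] [Lattice E] (e p : E) : Prop :=
  0 ≤ p ∧ p ≤ e ∧ p ⊓ (e - p) = 0

/-- The setting of the abstract Hahn-Jordan decomposition: a Dedekind complete Riesz
space `E` with weak order unit `e`, a Dedekind complete Riesz subspace `G` of `E`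
containing `e`, an order closed Boolean subalgebra `B` of the components of `e`
containing all components of `e` lying in `G`, and a map `ψ : B → G` which is
`K_G(e)`-homogeneous, additive on disjoint components, order continuous and order
bounded. -/
structure HJSetup (E : Type*) [AddCommGroup E] [ConditionallyCompleteLattice E]
    [CovariantClass E E (· + ·) (· ≤ ·)] [Module ℝ E] [PosSMulMono ℝ E] where
  /-- the weak order unit -/
  e : E
  /-- the Dedekind complete Riesz subspace `G` -/
  G : Set E
  /-- the Boolean algebra `B` of components of `e` -/
  B : Set E
  /-- the map `ψ : B → G` (values outside `B` are irrelevant) -/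
  ψ : E → E
  e_pos : 0 < e
  e_weak : ∀ x : E, 0 ≤ x → x ⊓ e = 0 → x = 0
  G_zero : (0 : E) ∈ G
  G_add : ∀ x ∈ G, ∀ y ∈ G, x + y ∈ G
  G_neg : ∀ x ∈ G, -x ∈ G
  G_smul : ∀ (c : ℝ), ∀ x ∈ G, c • x ∈ G
  G_sup : ∀ x ∈ G, ∀ y ∈ G, x ⊔ y ∈ G
  G_inf : ∀ x ∈ G, ∀ y ∈ G, x ⊓ y ∈ G
  /-- `G` is Dedekind complete (order closed in `E`) -/
  G_ded : ∀ S ⊆ G, S.Nonempty → BddAbove S → sSup S ∈ G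
  e_mem : e ∈ G
  B_comp : ∀ p ∈ B, IsComponent e p
  B_zero : (0 : E) ∈ B
  B_top : e ∈ B
  B_sup : ∀ p ∈ B, ∀ q ∈ B, p ⊔ q ∈ B
  B_inf : ∀ p ∈ B, ∀ q ∈ B, p ⊓ q ∈ B
  B_compl : ∀ p ∈ B, e - p ∈ B
  /-- `K_G(e) ⊆ B` -/
  KG_sub : ∀ p, IsComponent e p → p ∈ G → p ∈ B
  /-- `B` is order closed in `E`: if a (downward directed) net in `B` decreases to `p`
  in `E`, then `p ∈ B` -/
  B_orderClosed : ∀ S ⊆ B, S.Nonempty → DirectedOn (· ≥ ·) S → sInf S ∈ B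
  ψ_mem : ∀ p ∈ B, ψ p ∈ G
  /-- (i) `ψ(pq) = q ψ(p)` for `p ∈ B`, `q ∈ K_G(e)` -/
  ψ_mul : ∀ p ∈ B, ∀ q, IsComponent e q → q ∈ G → ψ (p ⊓ q) = bandProj q (ψ p)
  /-- (ii) additivity on disjoint components -/
  ψ_add : ∀ p ∈ B, ∀ q ∈ B, p ⊓ q = 0 → ψ (p ⊔ q) = ψ p + ψ q
  /-- (iii) order continuity: if a net `(p_α)` in `B` decreases to `p` in `E`, then
  `ψ(p_α) → ψ(p)` in order -/
  ψ_ordCont : ∀ S ⊆ B, S.Nonempty → DirectedOn (· ≥ ·) S →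
    ∃ w : E → E, (∀ p ∈ S, ∀ q ∈ S, p ≤ q → w p ≤ w q) ∧
      sInf (w '' S) = 0 ∧ ∀ p ∈ S, |ψ p - ψ (sInf S)| ≤ w p
  /-- (iv) `ψ` is order bounded -/
  ψ_bdd : ∃ g : E, 0 ≤ g ∧ ∀ p ∈ B, |ψ p| ≤ g

namespace HJSetup

variable {E : Type*} [AddCommGroup E] [ConditionallyCompleteLattice E]
  [CovariantClass E E (· + ·) (· ≤ ·)] [Module ℝ E] [PosSMulMono ℝ E]

/-- `C(q) = {ψ(p) : p ∈ B, p ≤ q}`. -/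
def C (s : HJSetup E) (q : E) : Set E := {y | ∃ p ∈ s.B, p ≤ q ∧ y = s.ψ p}

/-- `α(q) = sup C(q)`. -/
noncomputable def alpha (s : HJSetup E) (q : E) : E := sSup (s.C q)

/-- `M(q) = {p ∈ B : p ≤ q, 2ψ(p) ≥ p α(q)}`. -/
def M (s : HJSetup E) (q : E) : Set E :=
  {p | p ∈ s.B ∧ p ≤ q ∧ bandProj p (s.alpha q) ≤ s.ψ p + s.ψ p}

/-- `q` is strongly positive with respect to `ψ`. -/
def StronglyPos (s : HJSetup E) (q : E) : Prop := ∀ p ∈ s.B, p ≤ q → 0 ≤ s.ψ p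

/-- `q` is strongly negative with respect to `ψ`. -/
def StronglyNeg (s : HJSetup E) (q : E) : Prop := ∀ p ∈ s.B, p ≤ q → s.ψ p ≤ 0

/-- `H = {p ∈ B : p strongly negative w.r.t. ψ}`. -/
def H (s : HJSetup E) : Set E := {p | p ∈ s.B ∧ s.StronglyNeg p}

end HJSetup

section LatticeOrderedGroup

variable {E : Type*} [AddCommGroup E] [Lattice E] [CovariantClass E E (· + ·) (· ≤ ·)]

theorem inf_add_nonpos {a b c : E} (hc : 0 ≤ c) (hab : a ⊓ b ≤ 0) (hac : a ⊓ c ≤ 0) :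
    a ⊓ (b + c) ≤ 0 := by
  refine le_trans (le_inf inf_le_left ?_) hac
  calc a ⊓ (b + c) ≤ (a + c) ⊓ (b + c) := inf_le_inf_right _ (le_add_of_nonneg_right hc)
    _ = a ⊓ b + c := (inf_add a b c).symm
    _ ≤ 0 + c := by gcongr
    _ = c := zero_add c

theorem inf_nsmul_nonpos {a b : E} (hb : 0 ≤ b) (hab : a ⊓ b ≤ 0) (n : ℕ) :
    a ⊓ n • b ≤ 0 := by
  induction n with
  | zero => simp
  | succ n ih => rw [succ_nsmul]; exact inf_add_nonpos hb ih hab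

theorem IsComponent.sup_compl {e p : E} (h : IsComponent e p) : p ⊔ (e - p) = e := by
  have := inf_add_sup p (e - p)
  rwa [h.2.2, zero_add, add_sub_cancel] at this

end LatticeOrderedGroup

theorem bddAbove_range_inf {α ι : Type*} [Lattice α] (x : α) (f : ι → α) :
    BddAbove (Set.range fun i => x ⊓ f i) :=
  ⟨x, by rintro _ ⟨i, rfl⟩; exact inf_le_left⟩

section DedekindComplete

variable {E : Type*} [AddCommGroup E] [ConditionallyCompleteLattice E] {e u w : E}

/-- The component of `e` generated by a positive element `u`: the band projection of `e` onto
the band generated by `u`. -/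
noncomputable def supportComponent (e u : E) : E := sSup (Set.range fun n : ℕ => e ⊓ n • u)

theorem inf_nsmul_le_supportComponent (e u : E) (n : ℕ) : e ⊓ n • u ≤ supportComponent e u :=
  le_csSup (bddAbove_range_inf e _) ⟨n, rfl⟩

theorem supportComponent_nonneg (he : 0 ≤ e) : 0 ≤ supportComponent e u := by
  simpa [he] using inf_nsmul_le_supportComponent e u 0

theorem supportComponent_le : supportComponent e u ≤ e :=
  csSup_le (Set.range_nonempty _) (by rintro _ ⟨n, rfl⟩; exact inf_le_left)

variable [CovariantClass E E (· + ·) (· ≤ ·)]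

theorem inf_csSup_le {S : Set E} {x c : E} (hS : S.Nonempty) (hb : BddAbove S)
    (h : ∀ t ∈ S, x ⊓ t ≤ c) : x ⊓ sSup S ≤ c := by
  have hsup : sSup S ≤ c + (x ⊔ sSup S) - x := by
    refine csSup_le hS fun t ht => ?_
    rw [le_sub_iff_add_le', ← inf_add_sup x t]
    exact add_le_add (h t ht) (sup_le_sup_left (le_csSup hb ht) x)
  rw [le_sub_iff_add_le', ← inf_add_sup x (sSup S)] at hsup
  exact le_of_add_le_add_right hsup

theorem isComponent_supportComponent (he : 0 ≤ e) : IsComponent e (supportComponent e u) := by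
  refine ⟨supportComponent_nonneg he, supportComponent_le, le_antisymm ?_
    (le_inf (supportComponent_nonneg he) (sub_nonneg.2 supportComponent_le))⟩
  rw [inf_comm]
  refine inf_csSup_le (Set.range_nonempty _) (bddAbove_range_inf e _) ?_
  rintro _ ⟨n, rfl⟩
  set a := e ⊓ n • u
  have key : (e - a) ⊓ supportComponent e u ≤ supportComponent e u - a := by
    refine inf_csSup_le (Set.range_nonempty _) (bddAbove_range_inf e _) ?_
    rintro _ ⟨m, rfl⟩
    rw [le_sub_iff_add_le, inf_add, sub_add_cancel]
    refine le_trans (inf_le_inf_left e ?_) (inf_nsmul_le_supportComponent e u (m + n))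
    rw [add_nsmul]
    exact add_le_add inf_le_right inf_le_right
  have := inf_add (e - supportComponent e u) a (supportComponent e u - a)
  have h2 : (e - supportComponent e u) ⊓ a + (supportComponent e u - a) =
      (e - a) ⊓ supportComponent e u := by
    rw [this]; congr 1 <;> abel
  rw [← h2] at key
  simpa using key

theorem inf_supportComponent_nonpos (hu : 0 ≤ u) (h : w ⊓ u ≤ 0) :
    w ⊓ supportComponent e u ≤ 0 := by
  refine inf_csSup_le (Set.range_nonempty _) (bddAbove_range_inf e _) ?_
  rintro _ ⟨n, rfl⟩
  exact (inf_le_inf_left w inf_le_right).trans (inf_nsmul_nonpos hu h n)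

theorem bandProj_neg (u x : E) : bandProj u (-x) = -bandProj u x := by
  simp [bandProj]

theorem bandProj_supportComponent_posPart_pos (he : 0 ≤ e)
    (hweak : ∀ x : E, 0 ≤ x → x ⊓ e = 0 → x = 0) {v : E} (hv : ¬ v ≤ 0) :
    0 < bandProj (supportComponent e (v ⊔ 0)) v := by
  set u := v ⊔ 0
  set w := -v ⊔ 0
  set k := supportComponent e u
  have hu0 : 0 ≤ u := le_sup_right
  have hk0 : 0 ≤ k := supportComponent_nonneg he
  have hwu : w ⊓ u ≤ 0 := (inf_comm w u).trans_le (posPart_inf_negPart_eq_zero v).le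
  have hne : u ≠ 0 := fun h => hv (sup_eq_right.1 h)
  have hneg : sSup (Set.range fun n : ℕ => w ⊓ n • |k|) ≤ 0 := by
    refine csSup_le (Set.range_nonempty _) ?_
    rintro _ ⟨n, rfl⟩
    rw [abs_of_nonneg hk0]
    exact inf_nsmul_nonpos hk0 (inf_supportComponent_nonpos hu0 hwu) n
  have hle : u ⊓ e ≤ sSup (Set.range fun n : ℕ => u ⊓ n • |k|) := by
    refine le_csSup_of_le (bddAbove_range_inf u _) ⟨1, rfl⟩ ?_
    simp only [abs_of_nonneg hk0, one_nsmul]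
    refine le_inf inf_le_left ?_
    rw [inf_comm]
    simpa using inf_nsmul_le_supportComponent e u 1
  have hpos : 0 < u ⊓ e :=
    lt_of_le_of_ne (le_inf hu0 he) fun h => hne (hweak u hu0 h.symm)
  exact sub_pos.2 (hneg.trans_lt (hpos.trans_le hle))

end DedekindComplete

namespace HJSetup

variable {E : Type*} [AddCommGroup E] [ConditionallyCompleteLattice E]
  [CovariantClass E E (· + ·) (· ≤ ·)] [Module ℝ E] [PosSMulMono ℝ E] (s : HJSetup E)

theorem supportComponent_mem_G {u : E} (hu : u ∈ s.G) : supportComponent s.e u ∈ s.G := by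
  refine s.G_ded _ ?_ (Set.range_nonempty _) (bddAbove_range_inf _ _)
  rintro _ ⟨n, rfl⟩
  refine s.G_inf _ s.e_mem _ ?_
  induction n with
  | zero => simpa using s.G_zero
  | succ n ih => rw [succ_nsmul]; exact s.G_add _ ih _ hu

theorem exists_component_bandProj_pos {v : E} (hv : v ∈ s.G) (h : ¬ v ≤ 0) :
    ∃ k, IsComponent s.e k ∧ k ∈ s.G ∧ 0 < bandProj k v :=
  ⟨_, isComponent_supportComponent s.e_pos.le,
    s.supportComponent_mem_G (s.G_sup _ hv _ s.G_zero),
    bandProj_supportComponent_posPart_pos s.e_pos.le s.e_weak h⟩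

theorem exists_le_psi_pos {p : E} (hp : p ∈ s.B) (h : ¬ s.ψ p ≤ 0) :
    ∃ r ∈ s.B, r ≤ p ∧ 0 < s.ψ r := by
  obtain ⟨k, hk, hkG, hpos⟩ := s.exists_component_bandProj_pos (s.ψ_mem p hp) h
  exact ⟨p ⊓ k, s.B_inf _ hp _ (s.KG_sub k hk hkG), inf_le_left, by rwa [s.ψ_mul p hp k hk hkG]⟩

theorem exists_psi_neg {p : E} (hp : p ∈ s.B) (h : ¬ 0 ≤ s.ψ p) : ∃ r ∈ s.B, s.ψ r < 0 := by
  obtain ⟨k, hk, hkG, hpos⟩ := s.exists_component_bandProj_pos (s.G_neg _ (s.ψ_mem p hp))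
    (by rwa [neg_nonpos])
  refine ⟨p ⊓ k, s.B_inf _ hp _ (s.KG_sub k hk hkG), ?_⟩
  rwa [s.ψ_mul p hp k hk hkG, ← neg_pos, ← bandProj_neg]

theorem psi_eq_inf_add_inf_compl {r p : E} (hr : r ∈ s.B) (hp : p ∈ s.B) :
    s.ψ r = s.ψ (r ⊓ p) + s.ψ (r ⊓ (s.e - p)) := by
  let : DistribLattice E := AddCommGroup.toDistribLattice E
  have hc := s.B_comp p hp
  rw [← s.ψ_add _ (s.B_inf _ hr _ hp) _ (s.B_inf _ hr _ (s.B_compl _ hp)), ← inf_sup_left,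
    hc.sup_compl, inf_of_le_left (s.B_comp r hr).2.1]
  rw [← inf_inf_distrib_left, hc.2.2, inf_of_le_right (s.B_comp r hr).1]

theorem sup_mem_H {p q : E} (hp : p ∈ s.H) (hq : q ∈ s.H) : p ⊔ q ∈ s.H := by
  let : DistribLattice E := AddCommGroup.toDistribLattice E
  refine ⟨s.B_sup _ hp.1 _ hq.1, fun r hr hle => ?_⟩
  rw [s.psi_eq_inf_add_inf_compl hr hp.1]
  refine add_nonpos (hp.2 _ (s.B_inf _ hr _ hp.1) inf_le_right)
    (hq.2 _ (s.B_inf _ hr _ (s.B_compl _ hp.1)) ?_)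
  calc r ⊓ (s.e - p) ≤ (p ⊔ q) ⊓ (s.e - p) := inf_le_inf_right _ hle
    _ = p ⊓ (s.e - p) ⊔ q ⊓ (s.e - p) := inf_sup_right _ _ _
    _ ≤ q := by
      rw [(s.B_comp p hp.1).2.2]
      exact sup_le (s.B_comp q hq.1).1 inf_le_left

theorem psi_csInf_le {S : Set E} {c : E} (hS : S ⊆ s.B) (hne : S.Nonempty)
    (hdir : DirectedOn (· ≥ ·) S) (h : ∀ r ∈ S, s.ψ r ≤ c) : s.ψ (sInf S) ≤ c := by
  obtain ⟨w, -, hw, hle⟩ := s.ψ_ordCont S hS hne hdir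
  rw [← sub_nonpos, ← hw]
  refine le_csInf (hne.image w) ?_
  rintro _ ⟨r, hr, rfl⟩
  calc s.ψ (sInf S) - c ≤ s.ψ (sInf S) - s.ψ r := sub_le_sub_left (h r hr) _
    _ = -(s.ψ r - s.ψ (sInf S)) := (neg_sub _ _).symm
    _ ≤ |s.ψ r - s.ψ (sInf S)| := neg_le_abs _
    _ ≤ w r := hle r hr

/-- A minimal element of `{r ∈ B : ψ r ≤ ψ p}` is strongly negative: removing from it a part
of positive `ψ`-value would decrease `ψ`. -/
theorem exists_mem_H_psi_le {p : E} (hp : p ∈ s.B) : ∃ r ∈ s.H, s.ψ r ≤ s.ψ p := by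
  obtain ⟨r, ⟨hrB, hrp⟩, hmin⟩ : ∃ r, Minimal (· ∈ {r | r ∈ s.B ∧ s.ψ r ≤ s.ψ p}) r := by
    obtain ⟨r, -, hr⟩ := zorn_le_nonempty₀ (α := Eᵒᵈ) {r : E | r ∈ s.B ∧ s.ψ r ≤ s.ψ p}
      (fun (c : Set E) hc hchain y hy => by
        have hcB : c ⊆ s.B := fun r hr => (hc hr).1
        have hdir : DirectedOn (· ≥ ·) c := IsChain.directedOn hchain
        exact ⟨(sInf c : E), ⟨s.B_orderClosed c hcB ⟨y, hy⟩ hdir,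
          s.psi_csInf_le hcB ⟨y, hy⟩ hdir fun r hr => (hc hr).2⟩,
          fun z hz => csInf_le (α := E) ⟨0, fun r hr => (s.B_comp r (hcB hr)).1⟩ hz⟩) p
      ⟨hp, le_rfl⟩
    exact ⟨r, hr⟩
  refine ⟨r, ⟨hrB, fun t ht htr => ?_⟩, hrp⟩
  by_contra hpos
  obtain ⟨t', ht', htt, hpos'⟩ := s.exists_le_psi_pos ht hpos
  have hdec := s.psi_eq_inf_add_inf_compl hrB ht'
  rw [inf_of_le_right (htt.trans htr)] at hdec
  have hlt : s.ψ (r ⊓ (s.e - t')) < s.ψ r := by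
    rw [hdec]; exact lt_add_of_pos_left _ hpos'
  have hle : r ≤ r ⊓ (s.e - t') :=
    hmin ⟨s.B_inf _ hrB _ (s.B_compl _ ht'), hlt.le.trans hrp⟩ inf_le_left
  rw [inf_eq_left.2 (le_inf_iff.1 hle).2] at hlt
  exact hlt.false

theorem psi_le_of_maximal {p q : E} (hp : p ∈ s.H) (hq : q ∈ s.H)
    (hmax : ∀ p ∈ s.H, q ≤ p → p = q) : s.ψ q ≤ s.ψ p := by
  have hpq : p ≤ q := sup_eq_right.1 (hmax _ (s.sup_mem_H hp hq) le_sup_right)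
  rw [s.psi_eq_inf_add_inf_compl hq.1 hp.1, inf_of_le_right hpq]
  exact add_le_of_nonpos_right
    (hq.2 _ (s.B_inf _ hq.1 _ (s.B_compl _ hp.1)) inf_le_left)

end HJSetup

/-- Suppose there exists `p ∈ B` with `ψ(p)` not `≥ 0`, and let `q` be
the maximal element of `H = {p ∈ B : p strongly negative w.r.t. ψ}`. Then
`ψ(q) = β := inf {ψ(p) : p ∈ H}` and `β < 0`. -/
theorem hj_psi_q_eq_beta {E : Type*} [AddCommGroup E]
    [ConditionallyCompleteLattice E] [CovariantClass E E (· + ·) (· ≤ ·)]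
    [Module ℝ E] [PosSMulMono ℝ E] (s : HJSetup E)
    (hex : ∃ p ∈ s.B, ¬ 0 ≤ s.ψ p)
    (q : E) (hq : q ∈ s.H) (hmax : ∀ p ∈ s.H, q ≤ p → p = q) :
    s.ψ q = sInf (s.ψ '' s.H) ∧ sInf (s.ψ '' s.H) < 0 := by
  have hleast : IsLeast (s.ψ '' s.H) (s.ψ q) := by
    refine ⟨⟨q, hq, rfl⟩, ?_⟩
    rintro _ ⟨p, hp, rfl⟩
    exact s.psi_le_of_maximal hp hq hmax
  rw [hleast.csInf_eq]
  refine ⟨rfl, ?_⟩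
  obtain ⟨p, hp, hneg⟩ := hex
  obtain ⟨r, hr, hr0⟩ := s.exists_psi_neg hp hneg
  obtain ⟨t, ht, htr⟩ := s.exists_mem_H_psi_le hr
  exact ((s.psi_le_of_maximal ht hq hmax).trans htr).trans_lt hr0
end

section
/- For y ∈ E := L²(T), define T_y(x) := T(xy) for all x ∈ E. Then T_y ∈ Ê, ‖T_y‖ = ‖y‖_{T,2}, and the map Ψ : y ↦ T_y is additive, R(T)-homogeneous, and injective. -/
/-- The setting of the Riesz-Frechet representation theorem, formulated inside the
universal completion `U = E_u` with its `f`-algebra structure whose multiplicative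
unit `1` is the chosen weak order unit `e` (with `Te = e`).  `L1` is the
`T`-universally complete space `E = L¹(T)`, `RT` is the range `R(T)` of the strictly
positive conditional expectation operator `T`, and `sqrt` is the (unique positive)
square root in the universally complete `f`-algebra `R(T)`. -/
structure CESetup (U : Type*) [CommRing U] [ConditionallyCompleteLattice U]
    [CovariantClass U U (· + ·) (· ≤ ·)] [Module ℝ U] [PosSMulMono ℝ U] where
  /-- `E = L¹(T)`, the natural domain of `T` -/
  L1 : Set U
  /-- `R(T)`, the range of `T` -/
  RT : Set U
  /-- the strictly positive conditional expectation operator -/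
  T : U → U
  /-- the square root in the universally complete `f`-algebra -/
  sqrt : U → U
  /-- `U` is an `f`-algebra: products of positives are positive -/
  mul_nonneg : ∀ x y : U, 0 ≤ x → 0 ≤ y → 0 ≤ x * y
  /-- `U` is an `f`-algebra: `x ⊓ y = 0` implies `(x z) ⊓ y = 0` for `z ≥ 0` -/
  falg : ∀ x y z : U, x ⊓ y = 0 → 0 ≤ z → (x * z) ⊓ y = 0
  one_pos : (0 : U) < 1
  /-- `e = 1` is a weak order unit -/
  one_weak : ∀ x : U, 0 ≤ x → x ⊓ 1 = 0 → x = 0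
  /-- `L¹(T)` is a Riesz subspace, in fact an order ideal, of `U` -/
  L1_zero : (0 : U) ∈ L1
  L1_add : ∀ x ∈ L1, ∀ y ∈ L1, x + y ∈ L1
  L1_smul : ∀ (c : ℝ), ∀ x ∈ L1, c • x ∈ L1
  L1_ideal : ∀ x : U, ∀ y ∈ L1, |x| ≤ |y| → x ∈ L1
  L1_one : (1 : U) ∈ L1
  /-- `L¹(T)` is an `R(T)`-module -/
  L1_module : ∀ r ∈ RT, ∀ x ∈ L1, r * x ∈ L1
  /-- `R(T)` is a Riesz subspace and subalgebra of `U`, contained in `L¹(T)` -/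
  RT_sub : RT ⊆ L1
  RT_zero : (0 : U) ∈ RT
  RT_one : (1 : U) ∈ RT
  RT_add : ∀ x ∈ RT, ∀ y ∈ RT, x + y ∈ RT
  RT_neg : ∀ x ∈ RT, -x ∈ RT
  RT_smul : ∀ (c : ℝ), ∀ x ∈ RT, c • x ∈ RT
  RT_mul : ∀ x ∈ RT, ∀ y ∈ RT, x * y ∈ RT
  RT_sup : ∀ x ∈ RT, ∀ y ∈ RT, x ⊔ y ∈ RT
  /-- `R(T)` is order closed in `U` -/
  RT_orderClosed : ∀ S ⊆ RT, S.Nonempty → BddAbove S → sSup S ∈ RT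
  /-- `T` is linear on `L¹(T)` -/
  T_add : ∀ x ∈ L1, ∀ y ∈ L1, T (x + y) = T x + T y
  T_smul : ∀ (c : ℝ), ∀ x ∈ L1, T (c • x) = c • T x
  /-- `T` is positive -/
  T_pos : ∀ x ∈ L1, 0 ≤ x → 0 ≤ T x
  /-- `T` is strictly positive -/
  T_strict : ∀ x ∈ L1, 0 ≤ x → T x = 0 → x = 0
  /-- `T` maps into `R(T)` -/
  T_mem : ∀ x ∈ L1, T x ∈ RT
  /-- `T` is a projection onto `R(T)` -/
  T_fix : ∀ r ∈ RT, T r = r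
  /-- `T e = e` for the weak order unit `e = 1` -/
  T_one : T 1 = 1
  /-- `T` is an averaging operator: `T(rg) = r T(g)` for `r ∈ R(T)`, `g ∈ L¹(T)` -/
  T_avg : ∀ r ∈ RT, ∀ g ∈ L1, T (r * g) = r * T g
  /-- `T` is order continuous -/
  T_ordCont : ∀ S ⊆ L1, S.Nonempty → DirectedOn (· ≥ ·) S → (∀ x ∈ S, 0 ≤ x) →
    sInf S = 0 → sInf (T '' S) = 0
  /-- `E` is `T`-universally complete, `E = L¹(T)`: every upward directed set of
  positive elements of `L¹(T)` whose `T`-image is order bounded has a supremum,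
  which lies in `L¹(T)` -/
  T_univComplete : ∀ S ⊆ L1, S.Nonempty → DirectedOn (· ≤ ·) S → (∀ x ∈ S, 0 ≤ x) →
    (∃ b : U, ∀ x ∈ S, T x ≤ b) → BddAbove S ∧ sSup S ∈ L1
  /-- properties of the square root -/
  sqrt_nonneg : ∀ x : U, 0 ≤ sqrt x
  sqrt_sq : ∀ x : U, 0 ≤ x → sqrt x * sqrt x = x
  sqrt_mem : ∀ x ∈ RT, 0 ≤ x → sqrt x ∈ RT

namespace CESetup

variable {U : Type*} [CommRing U] [ConditionallyCompleteLattice U]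
  [CovariantClass U U (· + ·) (· ≤ ·)] [Module ℝ U] [PosSMulMono ℝ U]

/-- `E = L²(T) = {f ∈ L¹(T) : f² ∈ L¹(T)}`. -/
def L2 (s : CESetup U) : Set U := {f | f ∈ s.L1 ∧ f * f ∈ s.L1}

/-- The `R(T)`-valued norm `‖f‖_{T,2} = (T(f²))^{1/2}` on `L²(T)`. -/
noncomputable def norm2 (s : CESetup U) (f : U) : U := s.sqrt (s.T (f * f))

/-- `F` is a `T`-linear functional on `E = L²(T)`: an additive, `R(T)`-homogeneous,
order continuous map `E → R(T)`. -/
def IsTLinear (s : CESetup U) (F : U → U) : Prop :=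
  (∀ f ∈ s.L2, F f ∈ s.RT) ∧
  (∀ f ∈ s.L2, ∀ g ∈ s.L2, F (f + g) = F f + F g) ∧
  (∀ r ∈ s.RT, ∀ f ∈ s.L2, F (r * f) = r * F f) ∧
  (∀ S ⊆ s.L2, S.Nonempty → DirectedOn (· ≥ ·) S → (∀ x ∈ S, 0 ≤ x) → sInf S = 0 →
    ∃ w : U → U, (∀ p ∈ S, ∀ q ∈ S, p ≤ q → w p ≤ w q) ∧ sInf (w '' S) = 0 ∧
      ∀ p ∈ S, |F p| ≤ w p)

/-- `F` is `T`-strongly bounded: `|F(g)| ≤ k ‖g‖_{T,2}` for some `k ∈ R(T)⁺`.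
The `T`-strong dual `Ê` consists of the `T`-strongly bounded `T`-linear functionals. -/
def IsStronglyBounded (s : CESetup U) (F : U → U) : Prop :=
  ∃ k ∈ s.RT, 0 ≤ k ∧ ∀ g ∈ s.L2, |F g| ≤ k * s.norm2 g

/-- The `R(T)`-valued norm on the `T`-strong dual `Ê`:
`‖F‖ = inf {k ∈ R(T)⁺ : |F(g)| ≤ k ‖g‖_{T,2} for all g}`. -/
noncomputable def opNorm (s : CESetup U) (F : U → U) : U :=
  sInf {k | k ∈ s.RT ∧ 0 ≤ k ∧ ∀ g ∈ s.L2, |F g| ≤ k * s.norm2 g}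

end CESetup

section LatticeOrdered

/-- Conditionally complete lattice-ordered groups are Archimedean. -/
theorem nonpos_of_forall_nsmul_le {G : Type*} [AddCommGroup G] [ConditionallyCompleteLattice G]
    [IsOrderedAddMonoid G] {z b : G} (h : ∀ n : ℕ, n • z ≤ b) : z ≤ 0 := by
  have hb : BddAbove (Set.range fun n : ℕ => n • z) := ⟨b, by rintro _ ⟨n, rfl⟩; exact h n⟩
  have hs : sSup (Set.range fun n : ℕ => n • z) ≤ sSup (Set.range fun n : ℕ => n • z) - z := by
    refine csSup_le (Set.range_nonempty _) ?_
    rintro _ ⟨n, rfl⟩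
    rw [le_sub_iff_add_le, ← succ_nsmul]
    exact le_csSup hb ⟨n + 1, rfl⟩
  simpa using hs

theorem le_of_nsmul_le_nsmul {G : Type*} [AddCommGroup G] [PartialOrder G]
    [IsOrderedAddMonoid G] [Module ℝ G] [PosSMulMono ℝ G] {n : ℕ} (hn : n ≠ 0) {a b : G}
    (h : n • a ≤ n • b) : a ≤ b := by
  have hn' : (n : ℝ) ≠ 0 := Nat.cast_ne_zero.2 hn
  have h2 : (n : ℝ)⁻¹ • ((n : ℝ) • a) ≤ (n : ℝ)⁻¹ • ((n : ℝ) • b) := by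
    rw [Nat.cast_smul_eq_nsmul, Nat.cast_smul_eq_nsmul]
    exact smul_le_smul_of_nonneg_left h (by positivity)
  rwa [inv_smul_smul₀ hn', inv_smul_smul₀ hn'] at h2

theorem nonpos_of_forall_le_nsmul {G : Type*} [AddCommGroup G] [PartialOrder G]
    [IsOrderedAddMonoid G] [Module ℝ G] [PosSMulMono ℝ G] {S : Set G} (hS : IsGLB S 0)
    {n : ℕ} (hn : n ≠ 0) {c : G} (h : ∀ p ∈ S, c ≤ n • p) : c ≤ 0 := by
  have hn' : (n : ℝ) ≠ 0 := Nat.cast_ne_zero.2 hn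
  have h0 : (n : ℝ)⁻¹ • c ≤ 0 := by
    refine hS.2 fun p hp => le_of_nsmul_le_nsmul hn ?_
    rw [← Nat.cast_smul_eq_nsmul ℝ, smul_inv_smul₀ hn']
    exact h p hp
  have h1 := smul_le_smul_of_nonneg_left h0 (Nat.cast_nonneg n : (0 : ℝ) ≤ n)
  rwa [smul_inv_smul₀ hn', smul_zero] at h1

end LatticeOrdered

namespace CESetup

variable {U : Type*} [CommRing U] [ConditionallyCompleteLattice U]
  [CovariantClass U U (· + ·) (· ≤ ·)] [Module ℝ U] [PosSMulMono ℝ U]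

theorem isOrderedRing (s : CESetup U) : IsOrderedRing U :=
  have : IsOrderedAddMonoid U :=
    { add_le_add_left := fun a b h c => by
        rw [add_comm a c, add_comm b c]; exact CovariantClass.elim c h }
  have : ZeroLEOneClass U := ⟨s.one_pos.le⟩
  .of_mul_nonneg s.mul_nonneg

theorem posPart_mul_negPart (s : CESetup U) (x : U) : x⁺ * x⁻ = 0 := by
  have h1 := s.falg _ _ _ (posPart_inf_negPart_eq_zero x) (negPart_nonneg x)
  rw [inf_comm] at h1
  have h2 := s.falg _ _ _ h1 (posPart_nonneg x)
  rwa [mul_comm x⁻, inf_idem] at h2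

theorem L1_neg (s : CESetup U) {x : U} (hx : x ∈ s.L1) : -x ∈ s.L1 := by
  simpa using s.L1_smul (-1) x hx

theorem T_neg (s : CESetup U) {x : U} (hx : x ∈ s.L1) : s.T (-x) = -s.T x := by
  simpa using s.T_smul (-1) x hx

theorem L2_smul (s : CESetup U) {r x : U} (hr : r ∈ s.RT) (hx : x ∈ s.L2) : r * x ∈ s.L2 := by
  refine ⟨s.L1_module _ hr _ hx.1, ?_⟩
  rw [mul_mul_mul_comm]
  exact s.L1_module _ (s.RT_mul _ hr _ hr) _ hx.2

theorem norm2_nonneg (s : CESetup U) (x : U) : 0 ≤ s.norm2 x := s.sqrt_nonneg _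

theorem norm2_neg (s : CESetup U) (x : U) : s.norm2 (-x) = s.norm2 x := by
  rw [norm2, norm2, neg_mul_neg]

theorem mul_negPart_eq (s : CESetup U) (x : U) : x * x⁻ = -(x⁻ * x⁻) := by
  conv_lhs => enter [1]; rw [← posPart_sub_negPart x]
  rw [sub_mul, s.posPart_mul_negPart, zero_sub]

theorem mul_posPart_eq (s : CESetup U) (x : U) : x * x⁺ = x⁺ * x⁺ := by
  conv_lhs => enter [1]; rw [← posPart_sub_negPart x]
  rw [sub_mul, mul_comm x⁻, s.posPart_mul_negPart, sub_zero]

theorem L1_sub (s : CESetup U) {x y : U} (hx : x ∈ s.L1) (hy : y ∈ s.L1) : x - y ∈ s.L1 := by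
  rw [sub_eq_add_neg]
  exact s.L1_add _ hx _ (s.L1_neg hy)

theorem T_sub (s : CESetup U) {x y : U} (hx : x ∈ s.L1) (hy : y ∈ s.L1) :
    s.T (x - y) = s.T x - s.T y := by
  rw [sub_eq_add_neg, s.T_add _ hx _ (s.L1_neg hy), s.T_neg hy, sub_eq_add_neg]

theorem L2_neg (s : CESetup U) {x : U} (hx : x ∈ s.L2) : -x ∈ s.L2 :=
  ⟨s.L1_neg hx.1, by rw [neg_mul_neg]; exact hx.2⟩

theorem mul_self_nonneg_of_fAlgebra (s : CESetup U) (x : U) : 0 ≤ x * x := by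
  have h : x * x = x⁺ * x⁺ + x⁻ * x⁻ := by
    conv_lhs => enter [2]; rw [← posPart_sub_negPart x]
    rw [mul_sub, s.mul_posPart_eq, s.mul_negPart_eq, sub_neg_eq_add]
  rw [h]
  exact add_nonneg (s.mul_nonneg _ _ (posPart_nonneg x) (posPart_nonneg x))
    (s.mul_nonneg _ _ (negPart_nonneg x) (negPart_nonneg x))

theorem T_mono (s : CESetup U) {x y : U} (hx : x ∈ s.L1) (hy : y ∈ s.L1) (h : x ≤ y) :
    s.T x ≤ s.T y := by
  rw [← sub_nonneg, ← s.T_sub hy hx]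
  exact s.T_pos _ (s.L1_sub hy hx) (sub_nonneg.2 h)

theorem two_mul_le (s : CESetup U) (x y : U) : 2 * (x * y) ≤ x * x + y * y := by
  rw [← sub_nonneg]
  convert s.mul_self_nonneg_of_fAlgebra (x - y) using 1
  ring

theorem T_mul_self_nonneg (s : CESetup U) {x : U} (hx : x ∈ s.L2) : 0 ≤ s.T (x * x) :=
  s.T_pos _ hx.2 (s.mul_self_nonneg_of_fAlgebra x)

theorem norm2_mem (s : CESetup U) {x : U} (hx : x ∈ s.L2) : s.norm2 x ∈ s.RT :=
  s.sqrt_mem _ (s.T_mem _ hx.2) (s.T_mul_self_nonneg hx)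

theorem norm2_mul_self (s : CESetup U) {x : U} (hx : x ∈ s.L2) :
    s.norm2 x * s.norm2 x = s.T (x * x) :=
  s.sqrt_sq _ (s.T_mul_self_nonneg hx)

section FAlgebra

variable [IsOrderedRing U]

theorem abs_mul_abs_eq (s : CESetup U) (x : U) : |x| * |x| = x * x := by
  have h := s.posPart_mul_negPart x
  rw [← posPart_add_negPart x]
  conv_rhs => rw [← posPart_sub_negPart x]
  linear_combination 4 * h

theorem nonpos_of_mul_self_eq_zero (s : CESetup U) {x : U} (h : x * x = 0) : x ≤ 0 := by
  refine nonpos_of_forall_nsmul_le (b := 1) fun n => ?_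
  have h1 := s.two_mul_le (n • x) 1
  have h2 : (n • x) * (n • x) = 0 := by rw [smul_mul_smul_comm, h, smul_zero]
  rw [h2, zero_add, mul_one, mul_one, ← Nat.cast_two, ← nsmul_eq_mul] at h1
  refine le_of_nsmul_le_nsmul two_ne_zero (h1.trans ?_)
  rw [two_nsmul]
  exact le_add_of_nonneg_left s.one_pos.le

theorem eq_zero_of_mul_self_eq_zero (s : CESetup U) {x : U} (h : x * x = 0) : x = 0 := by
  refine le_antisymm (s.nonpos_of_mul_self_eq_zero h) ?_
  rw [← neg_nonpos]
  exact s.nonpos_of_mul_self_eq_zero (by rw [neg_mul_neg, h])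

theorem mul_negPart_eq_zero (s : CESetup U) {c d : U} (hc : 0 ≤ c) (h : 0 ≤ c * d) :
    c * d⁻ = 0 := by
  have hn := negPart_nonneg d
  have h1 : c * (d⁻ * d⁻) = 0 := by
    refine le_antisymm ?_ (s.mul_nonneg _ _ hc (s.mul_nonneg _ _ hn hn))
    have h2 := s.mul_nonneg _ _ h hn
    rw [mul_assoc, s.mul_negPart_eq, mul_neg] at h2
    exact neg_nonneg.1 h2
  exact s.eq_zero_of_mul_self_eq_zero (by linear_combination c * h1)

theorem nonneg_of_mul_nonneg_of_negPart_le (s : CESetup U) {c d : U} (hd : d⁻ ≤ c)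
    (h : 0 ≤ c * d) : 0 ≤ d := by
  have hn := negPart_nonneg d
  have h0 := s.mul_negPart_eq_zero (hn.trans hd) h
  have h1 : d⁻ * d⁻ = 0 :=
    le_antisymm ((mul_le_mul_of_nonneg_right hd hn).trans h0.le) (s.mul_nonneg _ _ hn hn)
  exact negPart_eq_zero.1 (s.eq_zero_of_mul_self_eq_zero h1)

theorem nonneg_of_mul_nonneg_of_one_le_nsmul (s : CESetup U) {c d : U} (hc : 0 ≤ c) {n : ℕ}
    (hn : 1 ≤ n • c) (h : 0 ≤ c * d) : 0 ≤ d := by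
  have h0 := s.mul_negPart_eq_zero hc h
  refine negPart_eq_zero.1 (le_antisymm ?_ (negPart_nonneg d))
  have := mul_le_mul_of_nonneg_right hn (negPart_nonneg d)
  rwa [one_mul, smul_mul_assoc, h0, smul_zero] at this

/-- Multiplication by a positive element is order continuous. -/
theorem isGLB_image_mul (s : CESetup U) {S : Set U} (hne : S.Nonempty)
    (hdir : DirectedOn (· ≥ ·) S) (hS : IsGLB S 0) {v : U} (hv : 0 ≤ v) :
    IsGLB ((fun p => p * v) '' S) 0 := by
  refine ⟨by rintro _ ⟨p, hp, rfl⟩; exact s.mul_nonneg _ _ (hS.1 hp) hv, fun z hz => ?_⟩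
  obtain ⟨p₀, hp₀⟩ := hne
  have hp₀' : 0 ≤ p₀ := hS.1 hp₀
  refine nonpos_of_forall_nsmul_le (b := p₀ * (v * v)) fun n => ?_
  rcases eq_or_ne n 0 with rfl | hn
  · rw [zero_smul]
    exact s.mul_nonneg _ _ hp₀' (s.mul_nonneg _ _ hv hv)
  have ha := posPart_nonneg (v - (n : U))
  have hav : (v - (n : U))⁺ ≤ v := by
    rw [posPart_def]
    exact sup_le (sub_le_self _ (Nat.cast_nonneg n)) hv
  have hna : n • (v - (n : U))⁺ ≤ v * v := by
    have h1 := s.mul_posPart_eq (v - (n : U))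
    have h2 : n • (v - (n : U))⁺ = v * (v - (n : U))⁺ - (v - (n : U))⁺ * (v - (n : U))⁺ := by
      rw [nsmul_eq_mul]
      linear_combination -h1
    rw [h2]
    exact (sub_le_self _ (s.mul_nonneg _ _ ha ha)).trans (mul_le_mul_of_nonneg_left hav hv)
  have hz' : z - p₀ * (v - (n : U))⁺ ≤ 0 := by
    refine nonpos_of_forall_le_nsmul hS hn fun p hp => ?_
    obtain ⟨q, hq, hqp, hqp₀⟩ := hdir p hp p₀ hp₀
    have hq' : 0 ≤ q := hS.1 hq
    have h1 : z ≤ q * v := hz ⟨q, hq, rfl⟩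
    have h2 : q * v ≤ q * ((v - (n : U))⁺ + n) :=
      mul_le_mul_of_nonneg_left (sub_le_iff_le_add.1 (le_posPart _)) hq'
    rw [mul_add, mul_comm q (n : U), ← nsmul_eq_mul] at h2
    have h3 : q * (v - (n : U))⁺ ≤ p₀ * (v - (n : U))⁺ := mul_le_mul_of_nonneg_right hqp₀ ha
    have h4 : n • q ≤ n • p := nsmul_le_nsmul_right hqp n
    rw [sub_le_iff_le_add']
    exact (h1.trans h2).trans (add_le_add h3 h4)
  calc n • z ≤ n • (p₀ * (v - (n : U))⁺) := nsmul_le_nsmul_right (sub_nonpos.1 hz') n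
    _ = p₀ * n • (v - (n : U))⁺ := (mul_smul_comm _ _ _).symm
    _ ≤ p₀ * (v * v) := mul_le_mul_of_nonneg_left hna hp₀'

theorem mul_mem_L1 (s : CESetup U) {x y : U} (hx : x ∈ s.L2) (hy : y ∈ s.L2) :
    x * y ∈ s.L1 := by
  have h0 : 0 ≤ x * x + y * y :=
    add_nonneg (s.mul_self_nonneg_of_fAlgebra x) (s.mul_self_nonneg_of_fAlgebra y)
  have key : ∀ x' : U, x' * x' = x * x → x' * y ≤ x * x + y * y := fun x' h => by
    refine le_of_nsmul_le_nsmul two_ne_zero ?_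
    have h1 := s.two_mul_le x' y
    rw [h, ← Nat.cast_two, ← nsmul_eq_mul] at h1
    refine h1.trans ?_
    rw [two_nsmul]
    exact le_add_of_nonneg_left h0
  refine s.L1_ideal _ _ (s.L1_add _ hx.2 _ hy.2) ?_
  rw [abs_of_nonneg h0]
  exact abs_le'.2 ⟨key x rfl, by simpa using key (-x) (neg_mul_neg x x)⟩

theorem L2_sub (s : CESetup U) {x y : U} (hx : x ∈ s.L2) (hy : y ∈ s.L2) : x - y ∈ s.L2 := by
  refine ⟨s.L1_sub hx.1 hy.1, ?_⟩
  have h := s.mul_mem_L1 hx hy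
  have h' : (x - y) * (x - y) = x * x + y * y - (x * y + x * y) := by ring
  rw [h']
  exact s.L1_sub (s.L1_add _ hx.2 _ hy.2) (s.L1_add _ h _ h)

theorem L2_abs (s : CESetup U) {x : U} (hx : x ∈ s.L2) : |x| ∈ s.L2 :=
  ⟨s.L1_ideal _ _ hx.1 (abs_abs x).le, by rw [s.abs_mul_abs_eq]; exact hx.2⟩

/-- If `a`, `c` dominate the norms of `x`, `y`, then expanding `0 ≤ T((c x - a y)²)`
gives a weighted Cauchy-Schwarz inequality. -/
theorem mul_sub_T_mul_nonneg (s : CESetup U) {x y a c : U} (hx : x ∈ s.L2) (hy : y ∈ s.L2)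
    (ha : a ∈ s.RT) (hc : c ∈ s.RT) (hxa : s.norm2 x ≤ a) (hyc : s.norm2 y ≤ c) :
    0 ≤ (a * c) * (a * c - s.T (x * y)) := by
  have hxy := s.mul_mem_L1 hx hy
  have hsq : ∀ {z b : U}, z ∈ s.L2 → s.norm2 z ≤ b → s.T (z * z) ≤ b * b := fun {z b} hz hb => by
    rw [← s.norm2_mul_self hz]
    exact mul_le_mul hb hb (s.norm2_nonneg z) ((s.norm2_nonneg z).trans hb)
  have h0 := s.T_mul_self_nonneg (s.L2_sub (s.L2_smul hc hx) (s.L2_smul ha hy))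
  have hcc := s.RT_mul _ hc _ hc
  have haa := s.RT_mul _ ha _ ha
  have hac := s.RT_mul _ ha _ hc
  have m1 := s.L1_module _ hcc _ hx.2
  have m2 := s.L1_module _ haa _ hy.2
  have m3 := s.L1_module _ hac _ hxy
  have h1 : (c * x - a * y) * (c * x - a * y) = (c * c) * (x * x) + (a * a) * (y * y)
      - ((a * c) * (x * y) + (a * c) * (x * y)) := by ring
  rw [h1, s.T_sub (s.L1_add _ m1 _ m2) (s.L1_add _ m3 _ m3), s.T_add _ m1 _ m2,
    s.T_add _ m3 _ m3, s.T_avg _ hcc _ hx.2, s.T_avg _ haa _ hy.2, s.T_avg _ hac _ hxy] at h0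
  have h2 : c * c * s.T (x * x) ≤ c * c * (a * a) :=
    mul_le_mul_of_nonneg_left (hsq hx hxa) (s.mul_self_nonneg_of_fAlgebra c)
  have h3 : a * a * s.T (y * y) ≤ a * a * (c * c) :=
    mul_le_mul_of_nonneg_left (hsq hy hyc) (s.mul_self_nonneg_of_fAlgebra a)
  refine le_of_nsmul_le_nsmul two_ne_zero ?_
  rw [smul_zero]
  refine h0.trans ((sub_le_sub_right (add_le_add h2 h3) _).trans (le_of_eq ?_))
  rw [nsmul_eq_mul]
  push_cast
  ring

/-- The conditional Cauchy-Schwarz inequality. -/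
theorem T_mul_le (s : CESetup U) {x y : U} (hx : x ∈ s.L2) (hy : y ∈ s.L2) :
    s.T (x * y) ≤ s.norm2 x * s.norm2 y := by
  have ha := s.norm2_nonneg x
  have hc := s.norm2_nonneg y
  rw [← sub_nonpos]
  refine nonpos_of_forall_nsmul_le (b := s.norm2 x + s.norm2 y + 1) fun n => ?_
  rcases eq_or_ne n 0 with rfl | hn
  · rw [zero_smul]
    exact add_nonneg (add_nonneg ha hc) s.one_pos.le
  have hn' : (n : ℝ) ≠ 0 := Nat.cast_ne_zero.2 hn
  set ε : U := (n : ℝ)⁻¹ • (1 : U) with hε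
  have hεR : ε ∈ s.RT := s.RT_smul _ _ s.RT_one
  have hnε : n • ε = 1 := by rw [hε, ← Nat.cast_smul_eq_nsmul ℝ, smul_inv_smul₀ hn']
  have hε0 : 0 ≤ ε := smul_nonneg (by positivity) s.one_pos.le
  have hε1 : ε ≤ 1 := by
    rw [← hnε]
    exact le_self_nsmul hε0 hn
  have haε := add_nonneg ha hε0
  have hcε := add_nonneg hc hε0
  have hbig : 1 ≤ (n * n) • ((s.norm2 x + ε) * (s.norm2 y + ε)) := by
    have hεε : ε * ε ≤ (s.norm2 x + ε) * (s.norm2 y + ε) :=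
      mul_le_mul (le_add_of_nonneg_left ha) (le_add_of_nonneg_left hc) hε0 haε
    refine le_trans (le_of_eq ?_) (nsmul_le_nsmul_right hεε _)
    rw [← smul_mul_smul_comm, hnε, one_mul]
  have h := s.nonneg_of_mul_nonneg_of_one_le_nsmul (s.mul_nonneg _ _ haε hcε) hbig
    (s.mul_sub_T_mul_nonneg hx hy (s.RT_add _ (s.norm2_mem hx) _ hεR)
      (s.RT_add _ (s.norm2_mem hy) _ hεR) (le_add_of_nonneg_right hε0)
      (le_add_of_nonneg_right hε0))
  have h1 : s.T (x * y) - s.norm2 x * s.norm2 y ≤ ε * (s.norm2 x + s.norm2 y + 1) := by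
    have h2 : ε * ε ≤ ε * 1 := mul_le_mul_of_nonneg_left hε1 hε0
    rw [sub_le_iff_le_add']
    refine (sub_nonneg.1 h).trans ?_
    have h3 : (s.norm2 x + ε) * (s.norm2 y + ε)
        = s.norm2 x * s.norm2 y + (ε * (s.norm2 x + s.norm2 y) + ε * ε) := by ring
    rw [h3, mul_add ε _ 1]
    gcongr
  refine (nsmul_le_nsmul_right h1 n).trans (le_of_eq ?_)
  rw [← smul_mul_assoc, hnε, one_mul]

theorem abs_T_mul_le (s : CESetup U) {x y : U} (hx : x ∈ s.L2) (hy : y ∈ s.L2) :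
    |s.T (x * y)| ≤ s.norm2 y * s.norm2 x := by
  rw [mul_comm (s.norm2 y)]
  refine abs_le'.2 ⟨s.T_mul_le hx hy, ?_⟩
  rw [← s.T_neg (s.mul_mem_L1 hx hy), ← neg_mul, ← s.norm2_neg x]
  exact s.T_mul_le (s.L2_neg hx) hy

theorem isTLinear_T_mul (s : CESetup U) {y : U} (hy : y ∈ s.L2) :
    s.IsTLinear (fun x => s.T (x * y)) := by
  have hy' := s.L2_abs hy
  refine ⟨fun f hf => s.T_mem _ (s.mul_mem_L1 hf hy), fun f hf g hg => ?_, fun r hr f hf => ?_,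
    fun S hS hne hdir hpos hinf => ?_⟩
  · simp only [add_mul]
    exact s.T_add _ (s.mul_mem_L1 hf hy) _ (s.mul_mem_L1 hg hy)
  · simp only [mul_assoc]
    exact s.T_avg _ hr _ (s.mul_mem_L1 hf hy)
  have hmono : ∀ {p q : U}, p ≤ q → p * |y| ≤ q * |y| := fun h =>
    mul_le_mul_of_nonneg_right h (abs_nonneg y)
  refine ⟨fun p => s.T (p * |y|), fun p hp q hq hpq =>
    s.T_mono (s.mul_mem_L1 (hS hp) hy') (s.mul_mem_L1 (hS hq) hy') (hmono hpq), ?_,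
    fun p hp => ?_⟩
  · have hS0 : IsGLB S 0 := hinf ▸ isGLB_csInf hne ⟨0, fun x hx => hpos x hx⟩
    have hSy := s.isGLB_image_mul hne hdir hS0 (abs_nonneg y)
    have hT := s.T_ordCont ((fun p => p * |y|) '' S)
      (by rintro _ ⟨p, hp, rfl⟩; exact s.mul_mem_L1 (hS hp) hy') (hne.image _) ?_
      (fun x hx => hSy.1 hx) (hSy.csInf_eq (hne.image _))
    · rwa [Set.image_image] at hT
    · rintro _ ⟨p, hp, rfl⟩ _ ⟨q, hq, rfl⟩
      obtain ⟨t, ht, htp, htq⟩ := hdir p hp q hq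
      exact ⟨_, ⟨t, ht, rfl⟩, hmono htp, hmono htq⟩
  · have hpy := s.mul_mem_L1 (hS hp) hy
    have hpy' := s.mul_mem_L1 (hS hp) hy'
    refine abs_le'.2 ⟨s.T_mono hpy hpy' (mul_le_mul_of_nonneg_left (le_abs_self y) (hpos p hp)), ?_⟩
    rw [← s.T_neg hpy]
    refine s.T_mono (s.L1_neg hpy) hpy' ?_
    rw [← mul_neg]
    exact mul_le_mul_of_nonneg_left (neg_le_abs y) (hpos p hp)

theorem opNorm_T_mul (s : CESetup U) {y : U} (hy : y ∈ s.L2) :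
    s.opNorm (fun x => s.T (x * y)) = s.norm2 y := by
  refine IsLeast.csInf_eq ⟨⟨s.norm2_mem hy, s.norm2_nonneg y, fun g hg => s.abs_T_mul_le hg hy⟩, ?_⟩
  rintro k ⟨-, hk, hky⟩
  have h : s.T (y * y) ≤ k * s.norm2 y := (le_abs_self _).trans (hky y hy)
  rw [← s.norm2_mul_self hy] at h
  rw [← sub_nonneg]
  refine s.nonneg_of_mul_nonneg_of_negPart_le (c := s.norm2 y) ?_ ?_
  · rw [negPart_def, neg_sub]
    exact sup_le (sub_le_self _ hk) (s.norm2_nonneg y)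
  · rw [mul_sub, sub_nonneg, mul_comm _ k]
    exact h

end FAlgebra

end CESetup

/-- For `y ∈ E := L²(T)`, define `T_y(x) := T(xy)` for all `x ∈ E`.
Then `T_y ∈ Ê`, `‖T_y‖ = ‖y‖_{T,2}`, and the map `Ψ : y ↦ T_y` is additive,
`R(T)`-homogeneous and injective. -/
theorem ce_dual_map {U : Type*} [CommRing U] [ConditionallyCompleteLattice U]
    [CovariantClass U U (· + ·) (· ≤ ·)] [Module ℝ U] [PosSMulMono ℝ U]
    (s : CESetup U) :
    (∀ y ∈ s.L2,
      s.IsTLinear (fun x => s.T (x * y)) ∧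
      s.IsStronglyBounded (fun x => s.T (x * y)) ∧
      s.opNorm (fun x => s.T (x * y)) = s.norm2 y) ∧
    (∀ y ∈ s.L2, ∀ z ∈ s.L2, ∀ x ∈ s.L2,
      s.T (x * (y + z)) = s.T (x * y) + s.T (x * z)) ∧
    (∀ r ∈ s.RT, ∀ y ∈ s.L2, ∀ x ∈ s.L2, s.T (x * (r * y)) = r * s.T (x * y)) ∧
    (∀ y ∈ s.L2, ∀ z ∈ s.L2, (∀ x ∈ s.L2, s.T (x * y) = s.T (x * z)) → y = z) := by
  have := s.isOrderedRing
  refine ⟨fun y hy => ⟨s.isTLinear_T_mul hy, ⟨s.norm2 y, s.norm2_mem hy, s.norm2_nonneg y,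
    fun g hg => s.abs_T_mul_le hg hy⟩, s.opNorm_T_mul hy⟩, fun y hy z hz x hx => ?_,
    fun r hr y hy x hx => ?_, fun y hy z hz h => ?_⟩
  · rw [mul_add]
    exact s.T_add _ (s.mul_mem_L1 hx hy) _ (s.mul_mem_L1 hx hz)
  · rw [mul_left_comm]
    exact s.T_avg _ hr _ (s.mul_mem_L1 hx hy)
  · have hd := s.L2_sub hy hz
    refine sub_eq_zero.1 (s.eq_zero_of_mul_self_eq_zero
      (s.T_strict _ hd.2 (s.mul_self_nonneg_of_fAlgebra _) ?_))
    rw [mul_sub, s.T_sub (s.mul_mem_L1 hd hy) (s.mul_mem_L1 hd hz), h _ hd, sub_self]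
end

section
/- For each 𝔤 ∈ Ê, there is a component q of e in E such that 𝔤(pq) ≥ 0 and 𝔤((e − q)p) ≤ 0 for all components p of e in E. -/
section LatticeOrderedGroup

variable {U : Type*} [AddCommGroup U]

theorem add_inf_eq_zero [Lattice U] [AddLeftMono U] {a b w : U} (hb : 0 ≤ b)
    (ha0 : 0 ≤ a) (hw : 0 ≤ w) (haw : a ⊓ w = 0) (hbw : b ⊓ w = 0) : (a + b) ⊓ w = 0 := by
  apply le_antisymm _ (le_inf (add_nonneg ha0 hb) hw)
  have h : (a + b) ⊓ w ≤ b := by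
    rw [← sub_nonpos, ← haw]
    exact le_inf (sub_le_iff_le_add.2 inf_le_left) ((sub_le_self _ hb).trans inf_le_right)
  exact hbw ▸ le_inf h inf_le_right

theorem csSup_inf_eq_zero [ConditionallyCompleteLattice U] [AddLeftMono U] {S : Set U} {w : U}
    (hne : S.Nonempty) (hbdd : BddAbove S) (h : ∀ y ∈ S, y ⊓ w = 0) : sSup S ⊓ w = 0 := by
  apply le_antisymm
  · have hle : sSup S ≤ sSup S ⊔ w - w := csSup_le hne fun y hy => by
      rw [le_sub_iff_add_le, ← inf_add_sup y w, h y hy, zero_add]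
      exact sup_le_sup_right (le_csSup hbdd hy) w
    rw [le_sub_iff_add_le, ← inf_add_sup] at hle
    exact add_le_iff_nonpos_left.1 hle
  · obtain ⟨y, hy⟩ := hne
    rw [← h y hy]
    exact inf_le_inf_right w (le_csSup hbdd hy)

theorem IsComponent.csSup [ConditionallyCompleteLattice U] [AddLeftMono U] {e : U} {C : Set U}
    (hne : C.Nonempty) (hC : ∀ c ∈ C, IsComponent e c) : IsComponent e (sSup C) := by
  have hbdd : BddAbove C := ⟨e, fun c hc => (hC c hc).2.1⟩
  have hle : sSup C ≤ e := csSup_le hne fun c hc => (hC c hc).2.1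
  refine ⟨?_, hle, csSup_inf_eq_zero hne hbdd fun c hc => ?_⟩
  · obtain ⟨c, hc⟩ := hne
    exact (hC c hc).1.trans (le_csSup hbdd hc)
  · refine le_antisymm ?_ (le_inf (hC c hc).1 (sub_nonneg.2 hle))
    rw [← (hC c hc).2.2]
    exact inf_le_inf_left c (sub_le_sub_left (le_csSup hbdd hc) e)

end LatticeOrderedGroup

namespace CESetup

variable {U : Type*} [CommRing U] [ConditionallyCompleteLattice U]
  [CovariantClass U U (· + ·) (· ≤ ·)] [Module ℝ U] [PosSMulMono ℝ U]

theorem mul_le_mul_left' (s : CESetup U) {x y z : U} (hz : 0 ≤ z) (h : x ≤ y) :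
    z * x ≤ z * y := by
  have := s.mul_nonneg z (y - x) hz (sub_nonneg.2 h)
  rwa [mul_sub, sub_nonneg] at this

theorem mul_eq_zero_of_inf_eq_zero (s : CESetup U) {a b : U} (h : a ⊓ b = 0) : a * b = 0 := by
  have ha : 0 ≤ a := h ▸ inf_le_left
  have hb : 0 ≤ b := h ▸ inf_le_right
  have h₁ := s.falg a b b h hb
  rw [inf_comm] at h₁
  have h₂ := s.falg b (a * b) a h₁ ha
  rwa [mul_comm b a, inf_idem] at h₂

theorem isComponent_one_iff (s : CESetup U) {p : U} :
    IsComponent 1 p ↔ 0 ≤ p ∧ p ≤ 1 ∧ p * p = p := by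
  refine ⟨fun ⟨h0, h1, h⟩ => ⟨h0, h1, ?_⟩, fun ⟨h0, h1, h⟩ => ⟨h0, h1, ?_⟩⟩
  · linear_combination -(s.mul_eq_zero_of_inf_eq_zero h)
  · have hq : 0 ≤ 1 - p := sub_nonneg.2 h1
    refine le_antisymm ?_ (le_inf h0 hq)
    have e₁ : p * (p ⊓ (1 - p)) ≤ 0 := by
      refine (s.mul_le_mul_left' h0 inf_le_right).trans_eq ?_
      linear_combination -h
    have e₂ : (1 - p) * (p ⊓ (1 - p)) ≤ 0 := by
      refine (s.mul_le_mul_left' hq inf_le_left).trans_eq ?_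
      linear_combination -h
    calc p ⊓ (1 - p) = p * (p ⊓ (1 - p)) + (1 - p) * (p ⊓ (1 - p)) := by ring
      _ ≤ 0 := add_nonpos e₁ e₂

theorem isComponent_zero (s : CESetup U) : IsComponent (1 : U) 0 :=
  s.isComponent_one_iff.2 ⟨le_rfl, s.one_pos.le, mul_zero 0⟩

theorem isComponent_one (s : CESetup U) : IsComponent (1 : U) 1 :=
  s.isComponent_one_iff.2 ⟨s.one_pos.le, le_rfl, mul_one 1⟩

theorem isComponent_mul (s : CESetup U) {p q : U} (hp : IsComponent 1 p)
    (hq : IsComponent 1 q) : IsComponent 1 (p * q) := by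
  rw [s.isComponent_one_iff] at *
  refine ⟨s.mul_nonneg _ _ hp.1 hq.1, ?_, ?_⟩
  · exact (s.mul_le_mul_left' hp.1 hq.2.1).trans ((mul_one p).trans_le hp.2.1)
  · linear_combination q * q * hp.2.2 + p * hq.2.2

theorem isComponent_one_sub (s : CESetup U) {p : U} (hp : IsComponent 1 p) :
    IsComponent 1 (1 - p) := by
  rw [s.isComponent_one_iff] at *
  exact ⟨sub_nonneg.2 hp.2.1, sub_le_self _ hp.1, by linear_combination hp.2.2⟩

theorem isComponent_add (s : CESetup U) {p q : U} (hp : IsComponent 1 p)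
    (hq : IsComponent 1 q) (h : p * q = 0) : IsComponent 1 (p + q) := by
  have := s.isComponent_one_sub
    (s.isComponent_mul (s.isComponent_one_sub hp) (s.isComponent_one_sub hq))
  convert this using 1
  linear_combination h

theorem mul_eq_left_of_le (s : CESetup U) {p q : U} (hp : IsComponent 1 p)
    (hq : IsComponent 1 q) (h : p ≤ q) : p * q = p := by
  rw [s.isComponent_one_iff] at *
  have hq' : 0 ≤ 1 - q := sub_nonneg.2 hq.2.1
  have h₁ : (1 - q) * p ≤ 0 :=
    (s.mul_le_mul_left' hq' h).trans_eq (by linear_combination -hq.2.2)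
  linear_combination -(le_antisymm h₁ (s.mul_nonneg _ _ hq' hp.1))

theorem RT_inf (s : CESetup U) {x y : U} (hx : x ∈ s.RT) (hy : y ∈ s.RT) : x ⊓ y ∈ s.RT := by
  have := s.RT_neg _ (s.RT_sup _ (s.RT_neg _ hx) _ (s.RT_neg _ hy))
  rwa [neg_sup, neg_neg, neg_neg] at this

/-- The band projection onto the positive part of an element of `R(T)` is multiplication by a
component lying in `R(T)`. -/
theorem exists_isComponent_mul_eq_posPart (s : CESetup U) {x : U} (hx : x ∈ s.RT) :
    ∃ r ∈ s.RT, IsComponent 1 r ∧ r * x = x⁺ := by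
  have hxp : x⁺ ∈ s.RT := s.RT_sup _ hx _ s.RT_zero
  have hdisj : x⁺ ⊓ x⁻ = 0 := posPart_inf_negPart_eq_zero x
  set S : Set U := {y | y ∈ s.RT ∧ 0 ≤ y ∧ y ≤ 1 ∧ y ⊓ x⁻ = 0} with hS
  have hmono : ∀ {y z : U}, y ∈ s.RT → 0 ≤ y → y ≤ z → y ≤ 1 → z ⊓ x⁻ = 0 → y ∈ S :=
    fun hy h0 hyz h1 hz => ⟨hy, h0, h1,
      le_antisymm (hz ▸ inf_le_inf_right _ hyz) (le_inf h0 (negPart_nonneg x))⟩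
  have hne : S.Nonempty :=
    ⟨0, s.RT_zero, le_rfl, s.one_pos.le, inf_eq_left.2 (negPart_nonneg x)⟩
  have hbdd : BddAbove S := ⟨1, fun y hy => hy.2.2.1⟩
  set r := sSup S with hr
  have hrS : r ∈ S := ⟨s.RT_orderClosed S (fun y hy => hy.1) hne hbdd,
    hne.elim fun y hy => hy.2.1.trans (le_csSup hbdd hy), csSup_le hne fun y hy => hy.2.2.1,
    csSup_inf_eq_zero hne hbdd fun y hy => hy.2.2.2⟩
  obtain ⟨hrT, hr0, hr1, hrx⟩ := hrS
  have hq0 : 0 ≤ 1 - r := sub_nonneg.2 hr1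
  have hqT : 1 - r ∈ s.RT := by
    rw [sub_eq_add_neg]
    exact s.RT_add _ s.RT_one _ (s.RT_neg _ hrT)
  have hd0 : 0 ≤ r ⊓ (1 - r) := le_inf hr0 hq0
  have hcomp : r ⊓ (1 - r) = 0 := by
    have hdS : r ⊓ (1 - r) ∈ S :=
      hmono (s.RT_inf hrT hqT) hd0 inf_le_left (inf_le_left.trans hr1) hrx
    have hsum : r + r ⊓ (1 - r) ∈ S := by
      refine ⟨s.RT_add _ hrT _ hdS.1, add_nonneg hr0 hd0, ?_,
        add_inf_eq_zero hd0 hr0 (negPart_nonneg x) hrx hdS.2.2.2⟩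
      exact (add_le_add_right inf_le_right r).trans_eq (add_sub_cancel r 1)
    exact le_antisymm ((add_le_iff_nonpos_right _).1 (le_csSup hbdd hsum)) hd0
  have hle : x⁺ ⊓ 1 ≤ r := le_csSup hbdd <|
    hmono (s.RT_inf hxp s.RT_one) (le_inf (posPart_nonneg x) s.one_pos.le) inf_le_left
      inf_le_right hdisj
  have hout : (1 - r) ⊓ x⁺ = 0 := by
    refine le_antisymm ?_ (le_inf hq0 (posPart_nonneg x))
    rw [← hcomp]
    exact le_inf ((le_inf inf_le_right (inf_le_left.trans (sub_le_self _ hr0))).trans hle)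
      inf_le_left
  refine ⟨r, hrT, ⟨hr0, hr1, hcomp⟩, ?_⟩
  have e₁ := s.mul_eq_zero_of_inf_eq_zero hrx
  have e₂ := s.mul_eq_zero_of_inf_eq_zero hout
  have e₃ := posPart_sub_negPart x
  linear_combination -r * e₃ - e₁ - e₂

theorem isComponent_mem_L2 (s : CESetup U) {p : U} (hp : IsComponent 1 p) : p ∈ s.L2 := by
  rw [s.isComponent_one_iff] at hp
  have h : p ∈ s.L1 := s.L1_ideal p 1 s.L1_one (by
    rw [abs_of_nonneg hp.1, abs_of_nonneg s.one_pos.le]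
    exact hp.2.1)
  exact ⟨h, hp.2.2.symm ▸ h⟩

variable {s : CESetup U} {F : U → U}

theorem IsTLinear.map_zero (hF : s.IsTLinear F) : F 0 = 0 := by
  have := hF.2.2.1 0 s.RT_zero 0 (s.isComponent_mem_L2 s.isComponent_zero)
  rwa [zero_mul, zero_mul] at this

theorem IsTLinear.neg (hF : s.IsTLinear F) : s.IsTLinear fun x => -F x := by
  obtain ⟨hmem, hadd, hsmul, hcont⟩ := hF
  refine ⟨fun f hf => s.RT_neg _ (hmem f hf), fun f hf g hg => ?_, fun r hr f hf => ?_, ?_⟩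
  · simp only [hadd f hf g hg]
    ring
  · simp only [hsmul r hr f hf]
    ring
  · simpa only [abs_neg] using hcont

/-- A `T`-linear functional which is nonpositive on all `p * c`, `c` in a chain `C` of components,
is nonpositive on `p * sSup C`. -/
theorem IsTLinear.map_mul_csSup_nonpos (hF : s.IsTLinear F) {C : Set U} (hne : C.Nonempty)
    (hchain : IsChain (· ≤ ·) C) (hC : ∀ c ∈ C, IsComponent 1 c) {p : U}
    (hp : IsComponent 1 p) (h : ∀ c ∈ C, F (p * c) ≤ 0) : F (p * sSup C) ≤ 0 := by
  have hn : IsComponent 1 (sSup C) := IsComponent.csSup hne hC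
  have hbdd : BddAbove C := ⟨1, fun c hc => (hC c hc).2.1⟩
  have hcompl : ∀ c ∈ C, IsComponent 1 (p * (sSup C - c)) := fun c hc => by
    have h₁ := s.isComponent_mul hp (s.isComponent_mul hn (s.isComponent_one_sub (hC c hc)))
    have h₂ := s.mul_eq_left_of_le (hC c hc) hn (le_csSup hbdd hc)
    convert h₁ using 1
    linear_combination p * h₂
  have hmono : ∀ c d : U, c ≤ d → p * (sSup C - d) ≤ p * (sSup C - c) := fun c d hcd =>
    s.mul_le_mul_left' hp.1 (sub_le_sub_left hcd _)
  set S : Set U := (fun c => p * (sSup C - c)) '' C with hS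
  have hSne : S.Nonempty := hne.image _
  have hS0 : ∀ x ∈ S, 0 ≤ x := by
    rintro _ ⟨c, hc, rfl⟩
    exact (hcompl c hc).1
  obtain ⟨w, -, hw0, hw⟩ := hF.2.2.2 S
    (by
      rintro _ ⟨c, hc, rfl⟩
      exact s.isComponent_mem_L2 (hcompl c hc))
    hSne
    (by
      rintro _ ⟨c, hc, rfl⟩ _ ⟨d, hd, rfl⟩
      rcases hchain.total hc hd with hcd | hdc
      · exact ⟨_, ⟨d, hd, rfl⟩, hmono c d hcd, le_rfl⟩
      · exact ⟨_, ⟨c, hc, rfl⟩, le_rfl, hmono d c hdc⟩)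
    hS0
    (by
      refine le_antisymm ?_ (le_csInf hSne hS0)
      have hSb : BddBelow S := ⟨0, hS0⟩
      have hle : sSup C ≤ sSup C - sInf S := csSup_le hne fun c hc => by
        rw [le_sub_comm]
        refine (csInf_le hSb ⟨c, hc, rfl⟩).trans ?_
        change p * (sSup C - c) ≤ _
        rw [mul_comm]
        exact (s.mul_le_mul_left' (sub_nonneg.2 (le_csSup hbdd hc)) hp.2.1).trans_eq (mul_one _)
      exact (le_sub_self_iff _).1 hle)
  rw [← hw0]
  refine le_csInf (hSne.image w) ?_
  rintro _ ⟨_, ⟨c, hc, rfl⟩, rfl⟩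
  have hadd := hF.2.1 _ (s.isComponent_mem_L2 (s.isComponent_mul hp (hC c hc))) _
    (s.isComponent_mem_L2 (hcompl c hc))
  rw [← mul_add, add_sub_cancel] at hadd
  rw [hadd]
  have hle := add_le_add (h c hc) ((le_abs_self _).trans (hw _ ⟨c, hc, rfl⟩))
  rwa [zero_add] at hle

/-- A component `q` all of whose subcomponents have nonnegative image under `F`. -/
def IsPositiveComponent (F : U → U) (q : U) : Prop :=
  IsComponent 1 q ∧ ∀ p, IsComponent 1 p → 0 ≤ F (p * q)

theorem IsTLinear.exists_maximal_isPositiveComponent (hF : s.IsTLinear F) :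
    ∃ q, Maximal (IsPositiveComponent F) q := by
  obtain ⟨q, -, hq⟩ := zorn_le_nonempty₀ {q | IsPositiveComponent F q}
    (fun C hCs hchain c₀ hc₀ => by
      have hC : ∀ c ∈ C, IsComponent 1 c := fun c hc => (hCs hc).1
      refine ⟨sSup C, ⟨IsComponent.csSup ⟨c₀, hc₀⟩ hC, fun p hp => ?_⟩,
        fun c hc => le_csSup ⟨1, fun c hc => (hC c hc).2.1⟩ hc⟩
      exact neg_nonpos.1 <| hF.neg.map_mul_csSup_nonpos ⟨c₀, hc₀⟩ hchain hC hp
        fun c hc => neg_nonpos.2 ((hCs hc).2 p hp)) 0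
    ⟨s.isComponent_zero, fun p _ => by rw [mul_zero, hF.map_zero]⟩
  exact ⟨q, hq⟩

/-- Removing a maximal subcomponent with nonpositive image from a component leaves a positive
component. -/
theorem IsTLinear.exists_isPositiveComponent_sub (hF : s.IsTLinear F) {a : U}
    (ha : IsComponent 1 a) :
    ∃ n, 0 ≤ n ∧ F n ≤ 0 ∧ IsPositiveComponent F (a - n) := by
  obtain ⟨n, -, ⟨hn, hna, hFn⟩, hmax⟩ :=
    zorn_le_nonempty₀ {n | IsComponent 1 n ∧ n ≤ a ∧ F n ≤ 0}
      (fun C hCs hchain c₀ hc₀ => by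
        have hC : ∀ c ∈ C, IsComponent 1 c := fun c hc => (hCs hc).1
        have hF' := hF.map_mul_csSup_nonpos ⟨c₀, hc₀⟩ hchain hC s.isComponent_one
          fun c hc => by
            rw [one_mul]
            exact (hCs hc).2.2
        rw [one_mul] at hF'
        exact ⟨sSup C, ⟨IsComponent.csSup ⟨c₀, hc₀⟩ hC,
          csSup_le ⟨c₀, hc₀⟩ fun c hc => (hCs hc).2.1, hF'⟩,
          fun c hc => le_csSup ⟨1, fun c hc => (hC c hc).2.1⟩ hc⟩) 0
      ⟨s.isComponent_zero, ha.1, hF.map_zero.le⟩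
  have hmul := s.mul_eq_left_of_le hn ha hna
  have hb : IsComponent 1 (a - n) := by
    convert s.isComponent_mul ha (s.isComponent_one_sub hn) using 1
    linear_combination hmul
  refine ⟨n, hn.1, hFn, hb, fun p hp => ?_⟩
  have hpb := s.isComponent_mul hp hb
  have hpb2 := s.isComponent_mem_L2 hpb
  obtain ⟨r, hrT, hr, hrx⟩ :=
    s.exists_isComponent_mul_eq_posPart (s.RT_neg _ (hF.1 _ hpb2))
  have hm := s.isComponent_mul hr hpb
  have hFm : F (r * (p * (a - n))) = -(-F (p * (a - n)))⁺ := by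
    rw [hF.2.2.1 r hrT _ hpb2, ← hrx]
    ring
  have hidem := (s.isComponent_one_iff.1 hn).2.2
  have horth : n * (r * (p * (a - n))) = 0 := by
    linear_combination r * p * (hmul - hidem)
  have hmb : r * (p * (a - n)) ≤ a - n := by
    rw [← mul_assoc, mul_comm]
    exact (s.mul_le_mul_left' hb.1 (s.isComponent_mul hr hp).2.1).trans_eq (mul_one _)
  have hle : n + r * (p * (a - n)) ≤ n := by
    refine hmax ⟨s.isComponent_add hn hm horth, ?_, ?_⟩ (le_add_of_nonneg_right hm.1)
    · exact (add_le_add_right hmb n).trans_eq (add_sub_cancel n a)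
    · rw [hF.2.1 _ (s.isComponent_mem_L2 hn) _ (s.isComponent_mem_L2 hm), hFm]
      exact add_nonpos hFn (neg_nonpos.2 (posPart_nonneg _))
  have hm0 : r * (p * (a - n)) = 0 := le_antisymm ((add_le_iff_nonpos_right _).1 hle) hm.1
  rw [hm0, hF.map_zero, eq_comm, neg_eq_zero, posPart_eq_zero] at hFm
  exact neg_nonpos.1 hFm

theorem IsTLinear.isPositiveComponent_add (hF : s.IsTLinear F) {q b : U}
    (hq : IsPositiveComponent F q) (hb : IsPositiveComponent F b) (h : q * b = 0) :
    IsPositiveComponent F (q + b) := by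
  refine ⟨s.isComponent_add hq.1 hb.1 h, fun p hp => ?_⟩
  rw [mul_add, hF.2.1 _ (s.isComponent_mem_L2 (s.isComponent_mul hp hq.1)) _
    (s.isComponent_mem_L2 (s.isComponent_mul hp hb.1))]
  exact add_nonneg (hq.2 p hp) (hb.2 p hp)

end CESetup

/-- For each `𝔤 ∈ Ê` there is a component `q` of `e = 1` in `E` such
that `𝔤(pq) ≥ 0` and `𝔤((e - q)p) ≤ 0` for all components `p` of `e` in `E`. -/
theorem ce_hahn_jordan_dual {U : Type*} [CommRing U] [ConditionallyCompleteLattice U]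
    [CovariantClass U U (· + ·) (· ≤ ·)] [Module ℝ U] [PosSMulMono ℝ U]
    (s : CESetup U) (F : U → U) (hlin : s.IsTLinear F)
    (hbd : s.IsStronglyBounded F) :
    ∃ q : U, IsComponent (1 : U) q ∧
      (∀ p : U, IsComponent (1 : U) p → 0 ≤ F (p * q)) ∧
      (∀ p : U, IsComponent (1 : U) p → F ((1 - q) * p) ≤ 0) := by
  obtain ⟨q, hq, hmax⟩ := hlin.exists_maximal_isPositiveComponent
  refine ⟨q, hq.1, hq.2, fun p hp => ?_⟩
  have hc := s.isComponent_mul (s.isComponent_one_sub hq.1) hp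
  have hc2 := s.isComponent_mem_L2 hc
  obtain ⟨r, hrT, hr, hrx⟩ := s.exists_isComponent_mul_eq_posPart (hlin.1 _ hc2)
  have ha := s.isComponent_mul hr hc
  obtain ⟨n, hn, hFn, hb⟩ := hlin.exists_isPositiveComponent_sub ha
  have hba : (r * ((1 - q) * p) - n) * (r * ((1 - q) * p)) = r * ((1 - q) * p) - n :=
    s.mul_eq_left_of_le hb.1 ha (sub_le_self _ hn)
  have hidem := (s.isComponent_one_iff.1 hq.1).2.2
  have horth : q * (r * ((1 - q) * p) - n) = 0 := by
    linear_combination -q * hba - (r * ((1 - q) * p) - n) * r * p * hidem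
  have hle := hmax (hlin.isPositiveComponent_add hq hb horth) (le_add_of_nonneg_right hb.1.1)
  have hb0 : r * ((1 - q) * p) - n = 0 :=
    le_antisymm ((add_le_iff_nonpos_right _).1 hle) hb.1.1
  rw [← sub_eq_zero.1 hb0, hlin.2.2.1 r hrT _ hc2, hrx] at hFn
  exact (le_posPart _).trans hFn
end
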